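/- (Entropy identity for smooth solutions of the augmented system.) Let ê : M₃(ℝ)×M₃(ℝ)×ℝ×ℝ → ℝ, ê = ê(F,ζ,w,η), be C², and write ξ = (F,ζ,w), Σ̂ = ∇_ξ ê, θ̂ = ∂_η ê. Let y : ℝ³×(0,T) → ℝ³ be C², and let ξ = (F,ζ,w), v, η be C¹ functions on ℝ³×(0,T) (valued in ℝ¹⁹, ℝ³, ℝ respectively) with F(x,t) = ∇_x y(x,t), let r be a continuous function, and assume θ̂(ξ,η) ≠ 0 everywhere. If the equations ∂_t ξ^B = Σ_α ∂_α( Σ_i ∂Φ^B/∂F_{iα}(F) v_i ) for all B = 1,…,19, ∂_t v_i = Σ_α ∂_α( Σ_B (∂ê/∂ξ^B)(ξ,η) ∂Φ^B/∂F_{iα}(F) ) for all i, and ∂_t( (1/2)|v|² + ê(ξ,η) ) = Σ_α ∂_α( Σ_{B,i} (∂ê/∂ξ^B)(ξ,η) ∂Φ^B/∂F_{iα}(F) v_i ) + r hold pointwise, then the entropy equation ∂_t η = r / θ̂(ξ,η) holds pointwise. -/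

import Mathlib

open scoped BigOperators
noncomputable section

/-- 3×3 real matrices, modelled as `Fin 3 → Fin 3 → ℝ`. -/
abbrev Mat : Type := Fin 3 → Fin 3 → ℝ

/-- The Levi-Civita symbol on `{0,1,2}`. -/
def lc (i j k : Fin 3) : ℝ :=
  (((j : ℕ) : ℝ) - ((i : ℕ) : ℝ)) * (((k : ℕ) : ℝ) - ((i : ℕ) : ℝ)) *
    (((k : ℕ) : ℝ) - ((j : ℕ) : ℝ)) / 2

/-- The cofactor matrix `(cof F)_{iα} = (1/2) Σ ε_{ijk} ε_{αβγ} F_{jβ} F_{kγ}`. -/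
def cof (F : Mat) : Mat := fun i α =>
  (1 / 2) * ∑ j, ∑ k, ∑ β, ∑ γ, lc i j k * lc α β γ * F j β * F k γ

/-- The determinant `det F = (1/6) Σ ε_{ijk} ε_{αβγ} F_{iα} F_{jβ} F_{kγ}`. -/
def mdet (F : Mat) : ℝ :=
  (1 / 6) * ∑ i, ∑ j, ∑ k, ∑ α, ∑ β, ∑ γ, lc i j k * lc α β γ * F i α * F j β * F k γ

/-- Frobenius norm of a 3×3 matrix. -/
def frob (F : Mat) : ℝ := Real.sqrt (∑ i, ∑ j, F i j ^ 2)

/-- Space-time points `(x,t) ∈ ℝ³ × ℝ`. -/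
abbrev Pt : Type := (Fin 3 → ℝ) × ℝ

/-- The open time slab `ℝ³ × (0,T)`. -/
def oslab (T : ℝ) : Set Pt := {p | 0 < p.2 ∧ p.2 < T}

/-- Spatial partial derivative `∂_α f` of a scalar function on space-time. -/
def pdx (α : Fin 3) (f : Pt → ℝ) (p : Pt) : ℝ :=
  fderiv ℝ f p (Pi.single α 1, 0)

/-- Time derivative `∂_t f` of a scalar function on space-time. -/
def pdt (f : Pt → ℝ) (p : Pt) : ℝ :=
  fderiv ℝ f p (0, 1)

/-- The spatial gradient matrix `(∇ₓ y)_{iα} = ∂_α y_i`. -/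
def gradx (y : Pt → Fin 3 → ℝ) (p : Pt) : Mat :=
  fun i α => pdx α (fun q => y q i) p

/-- The extended state space `ξ = (F, ζ, w) ∈ M₃(ℝ) × M₃(ℝ) × ℝ ≅ ℝ¹⁹`. -/
abbrev Xi : Type := Mat × Mat × ℝ

/-- The direction `∂Φ/∂F_{iα}(F) ∈ ℝ¹⁹`, whose components are
`∂F_{jβ}/∂F_{iα} = δ_{ij}δ_{αβ}`, `∂(cof F)_{kγ}/∂F_{iα} = Σ_{j,β} ε_{ijk}ε_{αβγ}F_{jβ}`,
`∂(det F)/∂F_{iα} = (cof F)_{iα}`. -/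
def dPhiDir (F : Mat) (i α : Fin 3) : Xi :=
  (Pi.single i (Pi.single α 1),
   fun k γ => ∑ j, ∑ β, lc i j k * lc α β γ * F j β,
   cof F i α)

/-- `Σ_B (∂eh/∂ξ^B)(x) d^B`, the derivative of `eh` at `x` in the pure-`ξ` direction `d`. -/
def dXi (eh : Xi × ℝ → ℝ) (x : Xi × ℝ) (d : Xi) : ℝ :=
  fderiv ℝ eh x (d, 0)

/-- `θ̂ = ∂eh/∂η`. -/
def dEta (eh : Xi × ℝ → ℝ) (x : Xi × ℝ) : ℝ :=
  fderiv ℝ eh x (0, 1)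

lemma lc_swap_left (i j k : Fin 3) : lc j i k = -lc i j k := by
  unfold lc; ring

lemma lc_swap_outer (i j k : Fin 3) : lc k j i = -lc i j k := by
  unfold lc; ring

/-- A double sum of an antisymmetric function vanishes. -/
lemma sum_sum_eq_zero_of_antisymm {ι : Type*} [Fintype ι] (f : ι → ι → ℝ)
    (h : ∀ a b, f b a = -f a b) : ∑ a, ∑ b, f a b = 0 := by
  have h1 : ∑ a, ∑ b, f a b = -∑ a, ∑ b, f a b := by
    conv_lhs => rw [Finset.sum_comm]
    simp only [← Finset.sum_neg_distrib]
    exact Finset.sum_congr rfl fun a _ => Finset.sum_congr rfl fun b _ => h a b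
  linarith

lemma isOpen_oslab (T : ℝ) : IsOpen (oslab T) :=
  (isOpen_lt continuous_const continuous_snd).inter (isOpen_lt continuous_snd continuous_const)

lemma fderiv_entry {F : Pt → Mat} {p : Pt} (hF : DifferentiableAt ℝ F p) (u : Pt) (i j : Fin 3) :
    fderiv ℝ (fun q => F q i j) p u = fderiv ℝ F p u i j := by
  have h := hasFDerivAt_pi'.1 (hasFDerivAt_pi'.1 hF.hasFDerivAt i) j
  rw [h.fderiv]
  rfl

lemma pdx_mul {f g : Pt → ℝ} {p : Pt} (hf : DifferentiableAt ℝ f p)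
    (hg : DifferentiableAt ℝ g p) (α : Fin 3) :
    pdx α (fun q => f q * g q) p = pdx α f p * g p + f p * pdx α g p := by
  unfold pdx
  rw [fderiv_fun_mul hf hg]
  simp only [add_apply, smul_apply, smul_eq_mul]
  ring

lemma pdx_const_mul {f : Pt → ℝ} {p : Pt} (c : ℝ) (hf : DifferentiableAt ℝ f p) (α : Fin 3) :
    pdx α (fun q => c * f q) p = c * pdx α f p := by
  unfold pdx
  rw [fderiv_const_mul hf]
  rfl

lemma pdx_sum {ι : Type*} [Fintype ι] {f : ι → Pt → ℝ} {p : Pt}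
    (hf : ∀ i, DifferentiableAt ℝ (f i) p) (α : Fin 3) :
    pdx α (fun q => ∑ i, f i q) p = ∑ i, pdx α (f i) p := by
  unfold pdx
  rw [fderiv_fun_sum fun i _ => hf i]
  simp

/-- Product rule for the divergence of `Σ_i a_{iα} v_i`. -/
lemma sum_pdx_sum_mul {a : Fin 3 → Fin 3 → Pt → ℝ} {v : Pt → Fin 3 → ℝ} {p : Pt}
    (ha : ∀ i α, DifferentiableAt ℝ (a i α) p)
    (hv : ∀ i, DifferentiableAt ℝ (fun q => v q i) p) :
    ∑ α, pdx α (fun q => ∑ i, a i α q * v q i) p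
      = ∑ i, (∑ α, pdx α (a i α) p) * v p i
        + ∑ i, ∑ α, pdx α (fun q => v q i) p * a i α p := by
  simp only [Finset.sum_mul]
  have h : ∀ α, pdx α (fun q => ∑ i, a i α q * v q i) p
      = ∑ i, (pdx α (a i α) p * v p i + a i α p * pdx α (fun q => v q i) p) := fun α =>
    (pdx_sum (fun i => (ha i α).mul (hv i)) α).trans
      (Finset.sum_congr rfl fun i _ => pdx_mul (ha i α) (hv i) α)
  simp only [h]
  rw [← Finset.sum_add_distrib, Finset.sum_comm]
  refine Finset.sum_congr rfl fun i _ => ?_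
  rw [← Finset.sum_add_distrib]
  exact Finset.sum_congr rfl fun α _ => by ring

/-- Symmetry of the second spatial derivatives of a `C²` motion. -/
lemma pdx_gradx_symm {y : Pt → Fin 3 → ℝ} {p : Pt} (hy : ContDiffAt ℝ 2 y p) (i α β : Fin 3) :
    pdx β (fun q => gradx y q i α) p = pdx α (fun q => gradx y q i β) p := by
  have hyi : ContDiffAt ℝ 2 (fun q => y q i) p := contDiffAt_pi.1 hy i
  have hd : DifferentiableAt ℝ (fderiv ℝ fun q => y q i) p :=
    (hyi.fderiv_right (m := 1) (by norm_num)).differentiableAt (by norm_num)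
  have hsymm : IsSymmSndFDerivAt ℝ (fun q => y q i) p :=
    hyi.isSymmSndFDerivAt (by simp)
  have key : ∀ u u' : Pt, fderiv ℝ (fun q => fderiv ℝ (fun q => y q i) q u) p u'
      = fderiv ℝ (fderiv ℝ fun q => y q i) p u' u := fun u u' => by
    rw [fderiv_clm_apply hd (differentiableAt_const u)]
    simp
  unfold gradx pdx
  rw [key, key]
  exact hsymm _ _

/-- The linear-in-`F` minors are divergence free when the derivatives of `F` are symmetric. -/
lemma sum_pdx_dcof_eq_zero {F : Pt → Mat} {p : Pt}
    (hF : ∀ j β, DifferentiableAt ℝ (fun q => F q j β) p)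
    (hsymm : ∀ j α β, pdx β (fun q => F q j α) p = pdx α (fun q => F q j β) p)
    (i k γ : Fin 3) :
    ∑ α, pdx α (fun q => ∑ j, ∑ β, lc i j k * lc α β γ * F q j β) p = 0 := by
  have h : ∀ α, pdx α (fun q => ∑ j, ∑ β, lc i j k * lc α β γ * F q j β) p
      = ∑ j, ∑ β, lc i j k * lc α β γ * pdx α (fun q => F q j β) p := fun α => by
    rw [pdx_sum fun j => DifferentiableAt.fun_sum fun β _ => (hF j β).const_mul _]
    refine Finset.sum_congr rfl fun j _ => ?_
    rw [pdx_sum fun β => (hF j β).const_mul _]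
    exact Finset.sum_congr rfl fun β _ => pdx_const_mul _ (hF j β) α
  simp only [h]
  rw [Finset.sum_comm]
  refine Finset.sum_eq_zero fun j _ => sum_sum_eq_zero_of_antisymm _ fun α β => ?_
  rw [lc_swap_left α β, hsymm j α β]
  ring

/-- The Piola identity: the rows of the cofactor matrix are divergence free when the derivatives
of `F` are symmetric. -/
lemma sum_pdx_cof_eq_zero {F : Pt → Mat} {p : Pt}
    (hF : ∀ j β, DifferentiableAt ℝ (fun q => F q j β) p)
    (hsymm : ∀ j α β, pdx β (fun q => F q j α) p = pdx α (fun q => F q j β) p)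
    (i : Fin 3) :
    ∑ α, pdx α (fun q => cof (F q) i α) p = 0 := by
  have hd : ∀ α j k β γ, DifferentiableAt ℝ
      (fun q => lc i j k * lc α β γ * F q j β * F q k γ) p := fun α j k β γ =>
    ((hF j β).const_mul _).mul (hF k γ)
  have h : ∀ α, pdx α (fun q => cof (F q) i α) p
      = 1 / 2 * ∑ j, ∑ k, (∑ β, ∑ γ, lc i j k * lc α β γ * pdx α (fun q => F q j β) p * F p k γ
        + ∑ β, ∑ γ, lc i j k * lc α β γ * F p j β * pdx α (fun q => F q k γ) p) := fun α => by
    unfold cof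
    rw [pdx_const_mul _ (by fun_prop), pdx_sum fun j => by fun_prop]
    refine congrArg _ (Finset.sum_congr rfl fun j _ => ?_)
    rw [pdx_sum fun k => by fun_prop]
    refine Finset.sum_congr rfl fun k _ => ?_
    rw [pdx_sum fun β => by fun_prop, ← Finset.sum_add_distrib]
    refine Finset.sum_congr rfl fun β _ => ?_
    rw [pdx_sum fun γ => hd α j k β γ, ← Finset.sum_add_distrib]
    refine Finset.sum_congr rfl fun γ _ => ?_
    rw [pdx_mul ((hF j β).const_mul _) (hF k γ), pdx_const_mul _ (hF j β)]
  simp only [h]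
  rw [← Finset.mul_sum, Finset.sum_comm]
  refine mul_eq_zero_of_right _ (Finset.sum_eq_zero fun j _ => ?_)
  rw [Finset.sum_comm]
  refine Finset.sum_eq_zero fun k _ => ?_
  rw [Finset.sum_add_distrib]
  have h1 : ∑ α, ∑ β, ∑ γ, lc i j k * lc α β γ * pdx α (fun q => F q j β) p * F p k γ = 0 := by
    refine sum_sum_eq_zero_of_antisymm _ fun α β => ?_
    rw [← Finset.sum_neg_distrib]
    refine Finset.sum_congr rfl fun γ _ => ?_
    rw [lc_swap_left α β, hsymm j α β]
    ring
  have h2 : ∑ α, ∑ β, ∑ γ, lc i j k * lc α β γ * F p j β * pdx α (fun q => F q k γ) p = 0 := by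
    rw [Finset.sum_comm]
    refine Finset.sum_eq_zero fun β _ => sum_sum_eq_zero_of_antisymm _ fun α γ => ?_
    rw [lc_swap_outer α β γ, hsymm k α γ]
    ring
  rw [h1, h2, add_zero]

lemma differentiableAt_dPhiDir {F : Pt → Mat} {p : Pt}
    (hF : ∀ j β, DifferentiableAt ℝ (fun q => F q j β) p) (i α : Fin 3) :
    DifferentiableAt ℝ (fun q => dPhiDir (F q) i α) p := by
  unfold dPhiDir cof
  refine (differentiableAt_const _).prodMk (DifferentiableAt.prodMk ?_ (by fun_prop))
  exact differentiableAt_pi.2 fun k => differentiableAt_pi.2 fun γ => by fun_prop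

/-- entropy identity for smooth solutions of the augmented system.
If `(ξ, v, η)` is a `C¹` solution of the augmented polyconvex thermoelasticity system
(kinematic equations for `ξ = (F,ζ,w)`, momentum equation, energy balance) on
`ℝ³ × (0,T)` with `F = ∇ₓ y` for a `C²` motion `y`, `r` continuous and
`θ̂(ξ,η) = ∂_η eh(ξ,η) ≠ 0`, then the entropy equation `∂_t η = r / θ̂(ξ,η)` holds. -/
theorem entropy_identity_augmented (T : ℝ)
    (eh : Xi × ℝ → ℝ) (heh : ContDiff ℝ 2 eh)
    (y : Pt → Fin 3 → ℝ) (F ζ' : Pt → Mat) (w : Pt → ℝ)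
    (v : Pt → Fin 3 → ℝ) (η : Pt → ℝ) (r : Pt → ℝ)
    (hy : ContDiffOn ℝ 2 y (oslab T))
    (hF : ContDiffOn ℝ 1 F (oslab T)) (hζ : ContDiffOn ℝ 1 ζ' (oslab T))
    (hw : ContDiffOn ℝ 1 w (oslab T)) (hv : ContDiffOn ℝ 1 v (oslab T))
    (hη : ContDiffOn ℝ 1 η (oslab T)) (hr : ContinuousOn r (oslab T))
    (hgrad : ∀ p ∈ oslab T, ∀ i α : Fin 3, F p i α = pdx α (fun q => y q i) p)
    (hθ : ∀ p ∈ oslab T, dEta eh ((F p, ζ' p, w p), η p) ≠ 0)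
    -- the kinematic equations `∂_t ξ^B = Σ_α ∂_α ( Σ_i ∂Φ^B/∂F_{iα}(F) v_i )`:
    (hxi1 : ∀ p ∈ oslab T, ∀ j β : Fin 3,
      pdt (fun q => F q j β) p
        = ∑ α, pdx α
            (fun q => ∑ i,
              (if j = i then (1:ℝ) else 0) * (if β = α then (1:ℝ) else 0) * v q i) p)
    (hxi2 : ∀ p ∈ oslab T, ∀ k γ : Fin 3,
      pdt (fun q => ζ' q k γ) p
        = ∑ α, pdx α
            (fun q => ∑ i, (∑ j, ∑ β, lc i j k * lc α β γ * F q j β) * v q i) p)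
    (hxi3 : ∀ p ∈ oslab T,
      pdt w p = ∑ α, pdx α (fun q => ∑ i, cof (F q) i α * v q i) p)
    -- the momentum equation:
    (hmom : ∀ p ∈ oslab T, ∀ i : Fin 3,
      pdt (fun q => v q i) p
        = ∑ α, pdx α (fun q => dXi eh ((F q, ζ' q, w q), η q) (dPhiDir (F q) i α)) p)
    -- the energy balance:
    (hen : ∀ p ∈ oslab T,
      pdt (fun q => (1/2) * (∑ i, (v q i)^2) + eh ((F q, ζ' q, w q), η q)) p
        = (∑ α, pdx α
            (fun q => ∑ i, dXi eh ((F q, ζ' q, w q), η q) (dPhiDir (F q) i α) * v q i) p)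
          + r p) :
    ∀ p ∈ oslab T, pdt η p = r p / dEta eh ((F p, ζ' p, w p), η p) := by
  intro p hp
  have hnhds : oslab T ∈ nhds p := (isOpen_oslab T).mem_nhds hp
  have hFd : DifferentiableAt ℝ F p := (hF.contDiffAt hnhds).differentiableAt (by norm_num)
  have hζd : DifferentiableAt ℝ ζ' p := (hζ.contDiffAt hnhds).differentiableAt (by norm_num)
  have hwd : DifferentiableAt ℝ w p := (hw.contDiffAt hnhds).differentiableAt (by norm_num)
  have hvd : DifferentiableAt ℝ v p := (hv.contDiffAt hnhds).differentiableAt (by norm_num)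
  have hηd : DifferentiableAt ℝ η p := (hη.contDiffAt hnhds).differentiableAt (by norm_num)
  have hFc : ∀ j β, DifferentiableAt ℝ (fun q => F q j β) p := fun j β =>
    differentiableAt_pi.1 (differentiableAt_pi.1 hFd j) β
  have hvc : ∀ i, DifferentiableAt ℝ (fun q => v q i) p := differentiableAt_pi.1 hvd
  have hsymm : ∀ j α β, pdx β (fun q => F q j α) p = pdx α (fun q => F q j β) p := by
    have hev : ∀ j α, (fun q => F q j α) =ᶠ[nhds p] fun q => gradx y q j α := fun j α =>
      Filter.eventuallyEq_of_mem hnhds fun q hq => hgrad q hq j α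
    intro j α β
    have h := pdx_gradx_symm (hy.contDiffAt hnhds) j α β
    unfold pdx at h ⊢
    rwa [(hev j α).fderiv_eq, (hev j β).fderiv_eq]
  set X : Pt → Xi × ℝ := fun q => ((F q, ζ' q, w q), η q)
  have hX : HasFDerivAt X
      (((fderiv ℝ F p).prod ((fderiv ℝ ζ' p).prod (fderiv ℝ w p))).prod (fderiv ℝ η p)) p :=
    (hFd.hasFDerivAt.prodMk (hζd.hasFDerivAt.prodMk hwd.hasFDerivAt)).prodMk hηd.hasFDerivAt
  have hehd : DifferentiableAt ℝ eh (X p) := heh.differentiable (by norm_num) _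
  have hSd : ∀ i α, DifferentiableAt ℝ (fun q => dXi eh (X q) (dPhiDir (F q) i α)) p := by
    intro i α
    have h1 : DifferentiableAt ℝ (fun q => fderiv ℝ eh (X q)) p :=
      ((heh.fderiv_right (m := 1) (by norm_num)).differentiable (by norm_num) (X p)).comp p
        hX.differentiableAt
    exact h1.clm_apply ((differentiableAt_dPhiDir hFc i α).prodMk (differentiableAt_const _))
  have hkin : ((fderiv ℝ F p (0, 1), fderiv ℝ ζ' p (0, 1), fderiv ℝ w p (0, 1)) : Xi)
      = ∑ i, ∑ α, pdx α (fun q => v q i) p • dPhiDir (F p) i α := by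
    refine Prod.ext ?_ (Prod.ext ?_ ?_)
    · funext j β
      have h := hxi1 p hp j β
      rw [sum_pdx_sum_mul (fun i α => differentiableAt_const _) hvc] at h
      have hconst : ∀ (c : ℝ) (α : Fin 3), pdx α (fun _ => c) p = 0 := fun c α => by simp [pdx]
      have hsingle : ∀ i α : Fin 3, (Pi.single i (Pi.single α 1) : Mat) j β
          = (if j = i then 1 else 0) * (if β = α then 1 else 0) := fun i α => by
        by_cases hj : j = i <;> simp [Pi.single_apply, hj]
      simp only [hconst, zero_mul, Finset.sum_const_zero, zero_add] at h
      refine (fderiv_entry hFd _ j β).symm.trans (h.trans ?_)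
      simp only [dPhiDir, Prod.fst_sum, Finset.sum_apply, Prod.smul_fst, Pi.smul_apply,
        smul_eq_mul, hsingle]
    · funext k γ
      have h := hxi2 p hp k γ
      rw [sum_pdx_sum_mul (fun i α => by fun_prop) hvc] at h
      simp only [sum_pdx_dcof_eq_zero hFc hsymm, zero_mul, Finset.sum_const_zero, zero_add] at h
      refine (fderiv_entry hζd _ k γ).symm.trans (h.trans ?_)
      simp only [dPhiDir, Prod.snd_sum, Prod.fst_sum, Finset.sum_apply, Prod.smul_fst,
        Prod.smul_snd, Pi.smul_apply, smul_eq_mul]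
    · have h := hxi3 p hp
      rw [sum_pdx_sum_mul (fun i α => by unfold cof; fun_prop) hvc] at h
      simp only [sum_pdx_cof_eq_zero hFc hsymm, zero_mul, Finset.sum_const_zero, zero_add] at h
      refine h.trans ?_
      simp only [dPhiDir, Prod.snd_sum, Prod.smul_snd, smul_eq_mul]
  have hdXi : fderiv ℝ eh (X p)
      ((fderiv ℝ F p (0, 1), fderiv ℝ ζ' p (0, 1), fderiv ℝ w p (0, 1)), 0)
      = ∑ i, ∑ α, pdx α (fun q => v q i) p * dXi eh (X p) (dPhiDir (F p) i α) := by
    have h : ∀ d : Xi, fderiv ℝ eh (X p) (d, 0)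
        = (fderiv ℝ eh (X p)).comp (ContinuousLinearMap.inl ℝ Xi ℝ) d := fun d => rfl
    simp only [hkin, dXi, h, map_sum, map_smul, smul_eq_mul]
  have hlhs : pdt (fun q => (1/2) * (∑ i, (v q i)^2) + eh (X q)) p
      = ∑ i, pdt (fun q => v q i) p * v p i
        + (fderiv ℝ eh (X p)
            ((fderiv ℝ F p (0, 1), fderiv ℝ ζ' p (0, 1), fderiv ℝ w p (0, 1)), 0)
          + pdt η p * dEta eh (X p)) := by
    have h1 : HasFDerivAt (fun q => (1/2) * (∑ i, (v q i)^2) + eh (X q)) _ p :=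
      ((HasFDerivAt.fun_sum fun i _ => (hvc i).hasFDerivAt.pow 2).const_mul (1/2)).add
        (hehd.hasFDerivAt.comp p hX)
    have h2 : (((fderiv ℝ F p (0, 1), fderiv ℝ ζ' p (0, 1), fderiv ℝ w p (0, 1)),
          fderiv ℝ η p (0, 1)) : Xi × ℝ)
        = ((fderiv ℝ F p (0, 1), fderiv ℝ ζ' p (0, 1), fderiv ℝ w p (0, 1)), 0)
          + fderiv ℝ η p (0, 1) • ((0, 1) : Xi × ℝ) := by simp
    unfold pdt dEta
    rw [h1.fderiv, ← smul_eq_mul (fderiv ℝ η p (0, 1)), ← map_smul, ← map_add, ← h2]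
    simp only [add_apply, smul_apply,
      sum_apply, ContinuousLinearMap.comp_apply,
      ContinuousLinearMap.prod_apply, Finset.smul_sum, smul_eq_mul]
    congr 1
    refine Finset.sum_congr rfl fun i _ => ?_
    simp
    ring
  have henergy := hen p hp
  rw [hlhs, hdXi, sum_pdx_sum_mul hSd hvc,
    Finset.sum_congr rfl fun i _ => congrArg (· * v p i) (hmom p hp i)] at henergy
  rw [eq_div_iff (hθ p hp)]
  linarith
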